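/- For every α with 4φ ≤ α ≤ φ⁴, the two-dimensional Lebesgue measure of the set {(x,y) ∈ Ω_∞ : x·y > 1/α} equals 1 − (1/α)(1 + ln α − 4·artanh(r)) − φ̄·r, where r = √(1 − 4φ/α) and artanh denotes the inverse hyperbolic tangent. -/

import Mathlib

open Matrix MeasureTheory Filter Topology

noncomputable section

abbrev SL2 := Matrix.SpecialLinearGroup (Fin 2) ℝ

/-- The golden ratio φ = (1+√5)/2. -/
def phi : ℝ := (1 + Real.sqrt 5) / 2

/-- φ̄ = 1/φ. -/
def phib : ℝ := phi⁻¹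

/-- S = [[0,−1],[1,0]]. -/
def Smat : SL2 := ⟨!![0, -1; 1, 0], by norm_num [Matrix.det_fin_two_of]⟩

/-- P = [[1,φ],[0,1]]. -/
def Pmat : SL2 := ⟨!![1, phi; 0, 1], by norm_num [Matrix.det_fin_two_of]⟩

/-- The Veech group of the golden L: the subgroup generated by S and P. -/
def Γ : Subgroup SL2 := Subgroup.closure {Smat, Pmat}

/-- Linear action of a 2×2 matrix on ℝ². -/
def mact (g : Matrix (Fin 2) (Fin 2) ℝ) (v : ℝ × ℝ) : ℝ × ℝ :=
  (g 0 0 * v.1 + g 0 1 * v.2, g 1 0 * v.1 + g 1 1 * v.2)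

/-- Λ = Γ·(1,0)ᵀ. -/
def Λ : Set (ℝ × ℝ) := {v | ∃ γ ∈ Γ, v = mact (γ : Matrix (Fin 2) (Fin 2) ℝ) (1, 0)}

/-- g_{a,b} = [[a,b],[0,1/a]]. -/
def gab (a b : ℝ) : Matrix (Fin 2) (Fin 2) ℝ := !![a, b; 0, a⁻¹]

/-- h_s = [[1,0],[−s,1]]. -/
def hmat (s : ℝ) : Matrix (Fin 2) (Fin 2) ℝ := !![1, 0; -s, 1]

/-- Ω = {(a,b) : 0 < a ≤ 1, 1 − aφ < b ≤ 1}. -/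
def Ω : Set (ℝ × ℝ) := {p | 0 < p.1 ∧ p.1 ≤ 1 ∧ 1 - p.1 * phi < p.2 ∧ p.2 ≤ 1}

/-- Ω₁ = {(a,b) ∈ Ω : φ̄ ≤ a ≤ 1, 1 − aφ < b ≤ φ̄ − a}. -/
def Ω₁ : Set (ℝ × ℝ) :=
  {p | p ∈ Ω ∧ phib ≤ p.1 ∧ p.1 ≤ 1 ∧ 1 - p.1 * phi < p.2 ∧ p.2 ≤ phib - p.1}

/-- Ω_φ = {(a,b) ∈ Ω : φ̄² ≤ a ≤ 1, φ̄ − a < b ≤ φ̄ − aφ̄}. -/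
def Ωphi : Set (ℝ × ℝ) :=
  {p | p ∈ Ω ∧ phib ^ 2 ≤ p.1 ∧ p.1 ≤ 1 ∧ phib - p.1 < p.2 ∧ p.2 ≤ phib - p.1 * phib}

/-- Ω_∞ = {(a,b) ∈ Ω : φ̄ − aφ̄ < b ≤ 1}. -/
def Ωinf : Set (ℝ × ℝ) := {p | p ∈ Ω ∧ phib - p.1 * phib < p.2 ∧ p.2 ≤ 1}

-- The return time function R.
open Classical in
noncomputable def Rfun (p : ℝ × ℝ) : ℝ :=
  if p ∈ Ω₁ then 1 / (p.1 * (p.1 + p.2))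
  else if p ∈ Ωphi then 1 / (p.1 * (p.1 * phib + p.2))
  else 1 / (p.1 * p.2)

/-- The probability measure m with dm = (2/φ) da db on Ω. -/
noncomputable def m : Measure (ℝ × ℝ) := ENNReal.ofReal (2 / phi) • volume.restrict Ω

-- The golden-L BCZ map T.
open Classical in
noncomputable def Tmap (p : ℝ × ℝ) : ℝ × ℝ :=
  if p ∈ Ω₁ then
    ((p.1 + p.2) * phi,
      p.1 + p.2 * phi +
        (-(⌊(p.1 + p.2 * phi - 1) / (phi ^ 2 * (p.1 + p.2))⌋ : ℤ) : ℝ) * phi ^ 2 * (p.1 + p.2))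
  else if p ∈ Ωphi then
    (p.1 + p.2 * phi,
      p.2 + (-(⌊(p.2 - 1) / (phi * (p.1 + p.2 * phi))⌋ : ℤ) : ℝ) * phi * (p.1 + p.2 * phi))
  else
    (p.2, -p.1 + (-(⌊(-p.1 - 1) / (phi * p.2)⌋ : ℤ) : ℝ) * phi * p.2)

/-- The inverse hyperbolic tangent. -/
def artanh (x : ℝ) : ℝ := Real.log ((1 + x) / (1 - x)) / 2

theorem one_lt_phi : 1 < phi := by
  have h : (2 : ℝ) < Real.sqrt 5 := Real.lt_sqrt_of_sq_lt (by norm_num)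
  unfold phi
  linarith

theorem phi_sq : phi ^ 2 = phi + 1 := by
  have h : Real.sqrt 5 ^ 2 = 5 := Real.sq_sqrt (by norm_num)
  unfold phi
  linarith

theorem phi_lt_two : phi < 2 := by
  nlinarith [phi_sq, one_lt_phi]

theorem phib_eq : phib = phi - 1 := by
  have h := one_lt_phi
  unfold phib
  rw [inv_eq_one_div, div_eq_iff (by linarith)]
  linarith [phi_sq]

/-- The lower boundary of the region `{p ∈ Ωinf | c < p.1 * p.2}` over `0 < x ≤ 1`. -/
def lowerBoundary (c x : ℝ) : ℝ := max (c * x⁻¹) (max (1 - x * phi) (phib - x * phib))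

theorem lowerBoundary_lt_iff {c x y : ℝ} (hx : 0 < x) :
    lowerBoundary c x < y ↔ c < x * y ∧ 1 - x * phi < y ∧ phib - x * phib < y := by
  simp only [lowerBoundary, max_lt_iff]
  rw [← div_eq_mul_inv, div_lt_iff₀' hx]

theorem continuousOn_lowerBoundary {c : ℝ} {s : Set ℝ} (hs : ∀ x ∈ s, x ≠ 0) :
    ContinuousOn (lowerBoundary c) s := by
  unfold lowerBoundary
  exact (continuousOn_const.mul (continuousOn_inv₀.mono hs)).sup
    (by fun_prop : Continuous fun x : ℝ => max (1 - x * phi) (phib - x * phib)).continuousOn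

theorem measurable_lowerBoundary (c : ℝ) : Measurable (lowerBoundary c) := by
  unfold lowerBoundary
  fun_prop

theorem lowerBoundary_le_one {c x : ℝ} (hc : 0 < c) (hx : c ≤ x) : lowerBoundary c x ≤ 1 := by
  have hx0 : 0 < x := hc.trans_le hx
  have hφ := one_lt_phi
  have hφ2 := phi_lt_two
  simp only [lowerBoundary, phib_eq, max_le_iff]
  refine ⟨?_, ?_, ?_⟩
  · rw [← div_eq_mul_inv, div_le_one hx0]
    exact hx
  · nlinarith
  · nlinarith

/-- The area of the region above `xy = c` in `Ωinf`, as an integral of slice lengths. -/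
theorem volume_Ωinf_superlevel {c : ℝ} (hc : 0 < c) (hc1 : c ≤ 1) :
    (volume {p : ℝ × ℝ | p ∈ Ωinf ∧ c < p.1 * p.2}).toReal
      = ∫ x in c..1, (1 - lowerBoundary c x) := by
  have hset : {p : ℝ × ℝ | p ∈ Ωinf ∧ c < p.1 * p.2}
      = {p | p.1 ∈ Set.Ioc c 1 ∧ p.2 ∈ Set.Ioc (lowerBoundary c p.1) 1} := by
    ext ⟨x, y⟩
    simp only [Ωinf, Ω, Set.mem_ofPred_eq, Set.mem_Ioc]
    constructor
    · rintro ⟨⟨⟨hx, hx1, h1, hy⟩, h2, -⟩, h⟩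
      exact ⟨⟨by nlinarith, hx1⟩, (lowerBoundary_lt_iff hx).2 ⟨h, h1, h2⟩, hy⟩
    · rintro ⟨⟨hx, hx1⟩, h, hy⟩
      have hx0 := hc.trans hx
      obtain ⟨h, h1, h2⟩ := (lowerBoundary_lt_iff hx0).1 h
      exact ⟨⟨⟨hx0, hx1, h1, hy⟩, h2, hy⟩, h⟩
  have hmeas : MeasurableSet
      {p : ℝ × ℝ | p.1 ∈ Set.Ioc c 1 ∧ p.2 ∈ Set.Ioc (lowerBoundary c p.1) 1} := by
    have hf : Measurable fun p : ℝ × ℝ => lowerBoundary c p.1 :=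
      (measurable_lowerBoundary c).comp measurable_fst
    exact (measurable_fst measurableSet_Ioc).inter
      ((measurableSet_lt hf measurable_snd).inter (measurableSet_le measurable_snd measurable_const))
  have hslice : ∀ x : ℝ,
      volume (Prod.mk x ⁻¹' {p : ℝ × ℝ | p.1 ∈ Set.Ioc c 1 ∧ p.2 ∈ Set.Ioc (lowerBoundary c p.1) 1})
        = (Set.Ioc c 1).indicator (fun x => ENNReal.ofReal (1 - lowerBoundary c x)) x := by
    intro x
    by_cases hx : x ∈ Set.Ioc c 1
    · rw [Set.indicator_of_mem hx, ← Real.volume_Ioc]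
      congr 1
      ext y
      simp [hx.1, hx.2]
    · rw [Set.indicator_of_notMem hx]
      convert measure_empty (μ := (volume : Measure ℝ))
      ext y
      simp only [Set.mem_preimage, Set.mem_ofPred_eq, Set.mem_empty_iff_false, iff_false]
      exact fun h => hx h.1
  rw [hset, Measure.volume_eq_prod, Measure.prod_apply hmeas]
  simp_rw [hslice]
  rw [lintegral_indicator measurableSet_Ioc, intervalIntegral.integral_of_le hc1,
    integral_eq_lintegral_of_nonneg_ae]
  · refine (ae_restrict_iff' measurableSet_Ioc).2 (Filter.Eventually.of_forall fun x hx => ?_)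
    exact sub_nonneg.2 (lowerBoundary_le_one hc hx.1.le)
  · exact (measurable_const.sub (measurable_lowerBoundary c)).aestronglyMeasurable

theorem integral_eq_log_of_eqOn {f : ℝ → ℝ} {a b c : ℝ} (ha : 0 < a) (hab : a ≤ b)
    (h : ∀ x ∈ Set.Icc a b, f x = c * x⁻¹) :
    ∫ x in a..b, f x = c * (Real.log b - Real.log a) := by
  have hb := ha.trans_le hab
  rw [intervalIntegral.integral_congr (g := fun x => c * x⁻¹)
      (fun x hx => h x (Set.uIcc_of_le hab ▸ hx)),
    intervalIntegral.integral_const_mul, integral_inv_of_pos ha hb, Real.log_div hb.ne' ha.ne']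

theorem integral_eq_of_eqOn_affine {f : ℝ → ℝ} {a b u v : ℝ} (hab : a ≤ b)
    (h : ∀ x ∈ Set.Icc a b, f x = u - x * v) :
    ∫ x in a..b, f x = u * (b - a) - v * (b ^ 2 - a ^ 2) / 2 := by
  rw [intervalIntegral.integral_congr (g := fun x => u - x * v)
      (fun x hx => h x (Set.uIcc_of_le hab ▸ hx)),
    intervalIntegral.integral_sub (by simp)
      ((by fun_prop : Continuous fun x : ℝ => x * v).intervalIntegrable _ _)]
  simp
  ring

section Pieces

variable {r x : ℝ}

theorem one_sub_mul_phi_sub (hx : x ≠ 0) :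
    (phi - 1) * (1 - r ^ 2) / 4 * x⁻¹ - (1 - x * phi)
      = phi * (x - (phi - 1) * (1 - r) / 2) * (x - (phi - 1) * (1 + r) / 2) * x⁻¹ := by
  field_simp
  linear_combination 4 * (4 * x - (phi - 1) * (1 - r ^ 2)) * phi_sq

theorem phib_sub_mul_phib_sub (hx : x ≠ 0) :
    (phi - 1) * (1 - r ^ 2) / 4 * x⁻¹ - (phib - x * phib)
      = (phi - 1) * (x - (1 - r) / 2) * (x - (1 + r) / 2) * x⁻¹ := by
  rw [phib_eq]
  field_simp
  ring

theorem lowerBoundary_eq_hyperbola (hx : 0 < x)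
    (h1 : 0 ≤ (x - (phi - 1) * (1 - r) / 2) * (x - (phi - 1) * (1 + r) / 2))
    (h2 : 0 ≤ (x - (1 - r) / 2) * (x - (1 + r) / 2)) :
    lowerBoundary ((phi - 1) * (1 - r ^ 2) / 4) x = (phi - 1) * (1 - r ^ 2) / 4 * x⁻¹ := by
  have hφ := one_lt_phi
  refine max_eq_left (max_le (sub_nonneg.1 ?_) (sub_nonneg.1 ?_))
  · rw [one_sub_mul_phi_sub hx.ne', mul_assoc phi]
    exact mul_nonneg (mul_nonneg (by linarith) h1) (inv_nonneg.2 hx.le)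
  · rw [phib_sub_mul_phib_sub hx.ne', mul_assoc (phi - 1)]
    exact mul_nonneg (mul_nonneg (by linarith) h2) (inv_nonneg.2 hx.le)

theorem lowerBoundary_eq_left_line (hx : 0 < x) (hx2 : x ≤ 2 - phi)
    (h : (x - (phi - 1) * (1 - r) / 2) * (x - (phi - 1) * (1 + r) / 2) ≤ 0) :
    lowerBoundary ((phi - 1) * (1 - r ^ 2) / 4) x = 1 - x * phi := by
  have hφ := one_lt_phi
  have h12 : phib - x * phib ≤ 1 - x * phi := by
    rw [phib_eq]
    linarith
  rw [lowerBoundary, max_eq_left h12]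
  refine max_eq_right (sub_nonpos.1 ?_)
  rw [one_sub_mul_phi_sub hx.ne', mul_assoc phi]
  exact mul_nonpos_of_nonpos_of_nonneg (mul_nonpos_of_nonneg_of_nonpos (by linarith) h)
    (inv_nonneg.2 hx.le)

theorem lowerBoundary_eq_right_line (hx : 0 < x) (hx2 : 2 - phi ≤ x)
    (h : (x - (1 - r) / 2) * (x - (1 + r) / 2) ≤ 0) :
    lowerBoundary ((phi - 1) * (1 - r ^ 2) / 4) x = phib - x * phib := by
  have hφ := one_lt_phi
  have h12 : 1 - x * phi ≤ phib - x * phib := by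
    rw [phib_eq]
    linarith
  rw [lowerBoundary, max_eq_right h12]
  refine max_eq_right (sub_nonpos.1 ?_)
  rw [phib_sub_mul_phib_sub hx.ne', mul_assoc (phi - 1)]
  exact mul_nonpos_of_nonpos_of_nonneg (mul_nonpos_of_nonneg_of_nonpos (by linarith) h)
    (inv_nonneg.2 hx.le)

end Pieces

theorem integral_lowerBoundary {r : ℝ} (hr0 : 0 ≤ r) (hr : r ≤ 2 * phi - 3) :
    ∫ x in (phi - 1) * (1 - r ^ 2) / 4..1, lowerBoundary ((phi - 1) * (1 - r ^ 2) / 4) x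
      = (phi - 1) * (1 - r ^ 2) / 4
          * (-Real.log ((phi - 1) * (1 - r ^ 2) / 4) - 4 * artanh r) + phib * r := by
  have hφ := one_lt_phi
  have hφ2 := phi_lt_two
  have hφs := phi_sq
  have hφ5 : phi < 5 / 3 := by nlinarith
  have hr1 : r < 1 := by linarith
  set c := (phi - 1) * (1 - r ^ 2) / 4 with hc
  set a₁ := (phi - 1) * (1 - r) / 2 with ha₁
  set b₁ := (phi - 1) * (1 + r) / 2 with hb₁
  set a₂ := (1 - r) / 2 with ha₂
  set b₂ := (1 + r) / 2 with hb₂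
  have hc0 : 0 < c := by
    have : 0 < (phi - 1) * (1 - r ^ 2) := mul_pos (by linarith) (by nlinarith)
    linarith
  have hca : c ≤ a₁ := by
    have : 0 ≤ (phi - 1) * (1 - r) * (1 - r) :=
      mul_nonneg (mul_nonneg (by linarith) (by linarith)) (by linarith)
    nlinarith
  have hab₁ : a₁ ≤ b₁ := by
    have : 0 ≤ (phi - 1) * r := mul_nonneg (by linarith) hr0
    linarith
  have hb₁' : b₁ ≤ 2 - phi := by nlinarith
  have ha₂' : 2 - phi ≤ a₂ := by linarith
  have hab₂ : a₂ ≤ b₂ := by linarith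
  have hb₂' : b₂ ≤ 1 := by linarith
  have ha₁0 : 0 < a₁ := by linarith
  have hb₁0 : 0 < b₁ := by linarith
  have ha₂0 : 0 < a₂ := by linarith
  have hb₂0 : 0 < b₂ := by linarith
  have hint : ∀ {a b : ℝ}, 0 < a → a ≤ b → IntervalIntegrable (lowerBoundary c) volume a b := by
    intro a b ha hab
    refine (continuousOn_lowerBoundary fun x hx => ?_).intervalIntegrable
    rw [Set.uIcc_of_le hab] at hx
    exact (ha.trans_le hx.1).ne'
  have I₁ := integral_eq_log_of_eqOn (f := lowerBoundary c) hc0 hca fun x hx =>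
    lowerBoundary_eq_hyperbola (by linarith [hx.1])
      (mul_nonneg_of_nonpos_of_nonpos (by linarith [hx.2]) (by linarith [hx.2]))
      (mul_nonneg_of_nonpos_of_nonpos (by linarith [hx.2]) (by linarith [hx.2]))
  have I₂ := integral_eq_of_eqOn_affine (f := lowerBoundary c) hab₁ fun x hx =>
    lowerBoundary_eq_left_line (by linarith [hx.1]) (by linarith [hx.2])
      (mul_nonpos_of_nonneg_of_nonpos (by linarith [hx.1]) (by linarith [hx.2]))
  have I₃ := integral_eq_log_of_eqOn (f := lowerBoundary c) hb₁0 (hb₁'.trans ha₂') fun x hx =>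
    lowerBoundary_eq_hyperbola (by linarith [hx.1])
      (mul_nonneg (by linarith [hx.1]) (by linarith [hx.1]))
      (mul_nonneg_of_nonpos_of_nonpos (by linarith [hx.2]) (by linarith [hx.2]))
  have I₄ := integral_eq_of_eqOn_affine (f := lowerBoundary c) hab₂ fun x hx =>
    lowerBoundary_eq_right_line (by linarith [hx.1]) (by linarith [hx.1])
      (mul_nonpos_of_nonneg_of_nonpos (by linarith [hx.1]) (by linarith [hx.2]))
  have I₅ := integral_eq_log_of_eqOn (f := lowerBoundary c) hb₂0 hb₂' fun x hx =>
    lowerBoundary_eq_hyperbola (by linarith [hx.1])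
      (mul_nonneg (by linarith [hx.1]) (by linarith [hx.1]))
      (mul_nonneg (by linarith [hx.1]) (by linarith [hx.1]))
  have hi₁ := hint hc0 hca
  have hi₂ := hint ha₁0 hab₁
  have hi₃ := hint hb₁0 (hb₁'.trans ha₂')
  have hi₄ := hint ha₂0 hab₂
  have hi₅ := hint hb₂0 hb₂'
  rw [← intervalIntegral.integral_add_adjacent_intervals
      (((hi₁.trans hi₂).trans hi₃).trans hi₄) hi₅,
    ← intervalIntegral.integral_add_adjacent_intervals ((hi₁.trans hi₂).trans hi₃) hi₄,
    ← intervalIntegral.integral_add_adjacent_intervals (hi₁.trans hi₂) hi₃,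
    ← intervalIntegral.integral_add_adjacent_intervals hi₁ hi₂, I₁, I₂, I₃, I₄, I₅]
  have hφ0 : phi - 1 ≠ 0 := by linarith
  have hm : 1 - r ≠ 0 := by linarith
  have hp : 1 + r ≠ 0 := by linarith
  have L₁ : Real.log a₁ = Real.log (phi - 1) + Real.log (1 - r) - Real.log 2 := by
    rw [ha₁, Real.log_div (mul_ne_zero hφ0 hm) two_ne_zero, Real.log_mul hφ0 hm]
  have L₂ : Real.log b₁ = Real.log (phi - 1) + Real.log (1 + r) - Real.log 2 := by
    rw [hb₁, Real.log_div (mul_ne_zero hφ0 hp) two_ne_zero, Real.log_mul hφ0 hp]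
  have L₃ : Real.log a₂ = Real.log (1 - r) - Real.log 2 := Real.log_div hm two_ne_zero
  have L₄ : Real.log b₂ = Real.log (1 + r) - Real.log 2 := Real.log_div hp two_ne_zero
  have hlines : 1 * (b₁ - a₁) - phi * (b₁ ^ 2 - a₁ ^ 2) / 2
      + (phib * (b₂ - a₂) - phib * (b₂ ^ 2 - a₂ ^ 2) / 2) = phib * r := by
    rw [phib_eq, ha₁, hb₁, ha₂, hb₂]
    linear_combination (-(r * (phi - 1) / 2)) * hφs
  rw [L₁, L₂, L₃, L₄, Real.log_one, artanh, Real.log_div hp hm]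
  linear_combination hlines

/-- For 4φ ≤ α ≤ φ⁴, the area of {(x,y) ∈ Ω_∞ : xy > 1/α} equals
1 − (1/α)(1 + ln α − 4 artanh r) − φ̄ r, where r = √(1 − 4φ/α). -/
theorem F_inf_third_piece :
    ∀ α : ℝ, 4 * phi ≤ α → α ≤ phi ^ 4 →
      (volume {p : ℝ × ℝ | p ∈ Ωinf ∧ 1 / α < p.1 * p.2}).toReal
        = 1 - (1 / α) * (1 + Real.log α - 4 * artanh (Real.sqrt (1 - 4 * phi / α)))
          - phib * Real.sqrt (1 - 4 * phi / α) := by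
  intro α hα₁ hα₂
  have hφ := one_lt_phi
  have hφs := phi_sq
  have hα0 : 0 < α := by linarith
  have hquot : 4 * phi / α ≤ 1 := (div_le_one hα0).2 hα₁
  set r := Real.sqrt (1 - 4 * phi / α) with hr
  have hr0 : 0 ≤ r := Real.sqrt_nonneg _
  have hr2 : r ^ 2 = 1 - 4 * phi / α := Real.sq_sqrt (by linarith)
  have hc : 1 / α = (phi - 1) * (1 - r ^ 2) / 4 := by
    rw [hr2]
    field_simp
    linear_combination -4 * hφs
  have hφ3 : 3 / 2 < phi := by nlinarith
  have hr3 : r ≤ 2 * phi - 3 := by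
    refine Real.sqrt_le_iff.2 ⟨by linarith, ?_⟩
    have hφ4 : phi ^ 4 = 3 * phi + 2 := by
      linear_combination (phi ^ 2 + phi + 2) * hφs
    have h : 1 - (2 * phi - 3) ^ 2 ≤ 4 * phi / α := by
      rw [le_div_iff₀ hα0]
      nlinarith
    linarith
  have hc0 : 0 < 1 / α := one_div_pos.2 hα0
  have hc1 : 1 / α ≤ 1 := (div_le_one hα0).2 (by linarith)
  have hint : IntervalIntegrable (lowerBoundary (1 / α)) volume (1 / α) 1 := by
    refine (continuousOn_lowerBoundary fun x hx => ?_).intervalIntegrable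
    rw [Set.uIcc_of_le hc1] at hx
    exact (hc0.trans_le hx.1).ne'
  have hI := integral_lowerBoundary hr0 hr3
  rw [← hc] at hI
  rw [volume_Ωinf_superlevel hc0 hc1, intervalIntegral.integral_sub (by simp) hint, hI,
    one_div α, Real.log_inv]
  simp
  ring
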